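/- arXiv:1504.06454 — 2 statements merged into one kernel-verified Lean document; each statement's English description precedes it below -/
import Mathlib

section
/- There exists a finite simple graph that is a rectangle intersection graph but is not a pairwise compatibility graph (PCG). (Corollary 1, rectangle case.) -/
/-- `G` is a pairwise compatibility graph: there are a finite tree `T` with nonnegative
edge weights, an injection of the vertices of `G` into the leaves of `T`, and bounds
`0 ≤ dmin ≤ dmax` such that two distinct vertices are adjacent iff the weighted
tree-distance of the corresponding leaves lies in `[dmin, dmax]`. -/
def IsPCG {V : Type} [Fintype V] (G : SimpleGraph V) : Prop :=
  ∃ (n : ℕ) (T : SimpleGraph (Fin n)) (w : Sym2 (Fin n) → ℝ)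
      (f : V → Fin n) (dmin dmax : ℝ),
    T.Connected ∧ T.IsAcyclic ∧
    (∀ e ∈ T.edgeSet, 0 ≤ w e) ∧
    Function.Injective f ∧
    (∀ v : V, ∃! x : Fin n, T.Adj (f v) x) ∧
    0 ≤ dmin ∧ dmin ≤ dmax ∧
    ∀ u v : V, u ≠ v →
      (G.Adj u v ↔ ∃ p : T.Walk (f u) (f v), p.IsPath ∧
        dmin ≤ (p.edges.map w).sum ∧ (p.edges.map w).sum ≤ dmax)

/-- `G` is a rectangle intersection graph: vertices are represented by axis-parallel
closed rectangles `[a, b] × [c, d]` (possibly degenerate) in the plane, and two distinct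
vertices are adjacent iff their rectangles intersect. -/
def IsRectangleIntersectionGraph {V : Type} [Fintype V] (G : SimpleGraph V) : Prop :=
  ∃ a b c d : V → ℝ,
    (∀ v, a v ≤ b v) ∧ (∀ v, c v ≤ d v) ∧
    ∀ u v : V, u ≠ v →
      (G.Adj u v ↔
        ((Set.Icc (a u) (b u) ×ˢ Set.Icc (c u) (d u)) ∩
          (Set.Icc (a v) (b v) ×ˢ Set.Icc (c v) (d v))).Nonempty)

namespace PCGAux

open SimpleGraph

variable {V : Type} {T : SimpleGraph V}

/-- Total weight of a walk. -/
def wt (w : Sym2 V → ℝ) {u v : V} (p : T.Walk u v) : ℝ := (p.edges.map w).sum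

theorem wt_append (w : Sym2 V → ℝ) {u v x : V} (p : T.Walk u v) (q : T.Walk v x) :
    wt w (p.append q) = wt w p + wt w q := by
  simp [wt, Walk.edges_append]

theorem wt_reverse (w : Sym2 V → ℝ) {u v : V} (p : T.Walk u v) :
    wt w p.reverse = wt w p := by
  simp [wt, Walk.edges_reverse, List.map_reverse, List.sum_reverse]

theorem wt_nonneg (w : Sym2 V → ℝ) (hw : ∀ e ∈ T.edgeSet, 0 ≤ w e) {u v : V}
    (p : T.Walk u v) : 0 ≤ wt w p := by
  unfold wt
  apply List.sum_nonneg
  intro x hx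
  obtain ⟨e, he, rfl⟩ := List.mem_map.1 hx
  exact hw e (p.edges_subset_edgeSet he)

/-- Every walk towards a set reaches it for the first time. -/
theorem exists_gate (S : Set V) {z x : V} (q : T.Walk z x) (hx : x ∈ S) :
    ∃ p ∈ S, ∃ r : T.Walk z p, r.IsPath ∧ ∀ v ∈ r.support, v ∈ S → v = p := by
  classical
  suffices h : ∃ p ∈ S, ∃ r : T.Walk z p, ∀ v ∈ r.support, v ∈ S → v = p by
    obtain ⟨p, hp, r, hr⟩ := h
    exact ⟨p, hp, r.bypass, r.bypass_isPath, fun v hv => hr v (r.support_bypass_subset hv)⟩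
  induction q with
  | nil => exact ⟨_, hx, Walk.nil, by simp⟩
  | @cons u v y h q ih =>
    by_cases hu : u ∈ S
    · exact ⟨u, hu, Walk.nil, by simp⟩
    · obtain ⟨p, hp, r, hr⟩ := ih hx
      refine ⟨p, hp, Walk.cons h r, ?_⟩
      intro a ha haS
      rw [Walk.support_cons, List.mem_cons] at ha
      rcases ha with rfl | ha
      · exact absurd haS hu
      · exact hr a ha haS

theorem isPath_append_of {u v x : V} (p : T.Walk u v) (q : T.Walk v x) (hp : p.IsPath)
    (hq : q.IsPath) (h : ∀ a ∈ p.support, a ∈ q.support → a = v) : (p.append q).IsPath := by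
  induction p with
  | nil => simpa using hq
  | cons e p ih =>
    rw [Walk.cons_append, Walk.cons_isPath_iff]
    rw [Walk.cons_isPath_iff] at hp
    refine ⟨ih q hp.1 hq (fun a ha => h a (by simp [ha])), ?_⟩
    rw [Walk.mem_support_append_iff]
    rintro (h1 | h1)
    · exact hp.2 h1
    · have := h _ (by simp) h1
      subst this
      exact hp.2 p.end_mem_support

/-- Four-point condition for the path weights of a tree. -/
theorem four_point (hc : T.Connected) (ha : T.IsAcyclic) (w : Sym2 V → ℝ)
    (hw : ∀ e ∈ T.edgeSet, 0 ≤ w e) :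
    ∃ D : V → V → ℝ, (∀ u v (p : T.Walk u v), p.IsPath → wt w p = D u v) ∧
      (∀ u v, D u v = D v u) ∧
      ∀ x y z t, D x y + D z t ≤ D x z + D y t ∨ D x y + D z t ≤ D x t + D y z := by
  classical
  have hex : ∀ u v, ∃ p : T.Walk u v, p.IsPath := fun u v => by
    obtain ⟨p⟩ := hc.preconnected u v
    exact ⟨p.bypass, p.bypass_isPath⟩
  choose P hP using hex
  have hD : ∀ u v (p : T.Walk u v), p.IsPath → wt w p = wt w (P u v) := by
    intro u v p hp
    have := ha.path_unique ⟨p, hp⟩ ⟨P u v, hP u v⟩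
    rw [Subtype.mk.injEq] at this
    rw [this]
  obtain ⟨D, hDdef⟩ : ∃ D : V → V → ℝ, ∀ u v, D u v = wt w (P u v) := ⟨_, fun _ _ => rfl⟩
  simp only [← hDdef] at hD
  have hs : ∀ u v, D u v = D v u := by
    intro u v
    rw [← hD v u (P u v).reverse (hP u v).reverse, wt_reverse, hDdef]
  have hn : ∀ u v, 0 ≤ D u v := fun u v => by rw [hDdef]; exact wt_nonneg w hw _
  have hsplit : ∀ u v (q : T.Walk u v), q.IsPath → ∀ p ∈ q.support, D u v = D u p + D p v := by
    intro u v q hq p hp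
    rw [← hD u v q hq, ← hD u p (q.takeUntil p hp) (hq.takeUntil hp),
      ← hD p v (q.dropUntil p hp) (hq.dropUntil hp), ← wt_append, Walk.take_spec]
  have hgate : ∀ x y z, ∃ p ∈ (P x y).support, D x z = D x p + D p z ∧ D y z = D y p + D p z := by
    intro x y z
    obtain ⟨p, hp, r, hr, hrS⟩ := exists_gate {a | a ∈ (P x y).support} (P z x)
      (by simp)
    have hp' : p ∈ (P x y).support := hp
    refine ⟨p, hp, ?_, ?_⟩
    · have h1 : (r.append ((P x y).takeUntil p hp').reverse).IsPath := by
        apply isPath_append_of _ _ hr ((hP x y).takeUntil hp').reverse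
        intro a ha hb
        apply hrS a ha
        rw [Walk.support_reverse, List.mem_reverse] at hb
        exact (P x y).support_takeUntil_subset hp' hb
      have h2 := hsplit z x _ h1 p (by simp)
      rw [hs x z, h2, hs x p, hs p z]; ring
    · have h1 : (r.append ((P x y).dropUntil p hp')).IsPath := by
        apply isPath_append_of _ _ hr ((hP x y).dropUntil hp')
        intro a ha hb
        apply hrS a ha
        exact (P x y).support_dropUntil_subset hp' hb
      have h2 := hsplit z y _ h1 p (by simp)
      rw [hs y z, h2, hs y p, hs p z]; ring
  have htri : ∀ x y z, D x y ≤ D x z + D z y := by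
    intro x y z
    obtain ⟨p, hp, h1, h2⟩ := hgate x y z
    have h3 := hsplit x y _ (hP x y) p hp
    have := hn p z
    rw [hs z y, h1, h2, h3, hs p y]
    linarith
  refine ⟨D, hD, hs, ?_⟩
  intro x y z t
  obtain ⟨p, hp, h1, h2⟩ := hgate x y z
  obtain ⟨q, hq, h3, h4⟩ := hgate x y t
  have e1 := hsplit x y _ (hP x y) p hp
  have e2 := hsplit x y _ (hP x y) q hq
  have t1 := htri z t p
  have t2 := htri p t q
  rw [hs z p] at t1
  rw [hs p y] at e1
  rw [hs q y] at e2
  have hq' : q ∈ ((P x y).takeUntil p hp).support ∨ q ∈ ((P x y).dropUntil p hp).support := by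
    rw [← Walk.mem_support_append_iff, Walk.take_spec]; exact hq
  rcases hq' with h | h
  · have e3 := hsplit x p _ ((hP x y).takeUntil hp) q h
    rw [hs q p] at e3
    left; linarith
  · have e3 := hsplit p y _ ((hP x y).dropUntil hp) q h
    rw [hs p y, hs q y] at e3
    right; linarith

/-- The join of two copies of `2K₂`. -/
def G8 : SimpleGraph (Fin 8) where
  Adj u v := u ≠ v ∧ (u.val / 4 ≠ v.val / 4 ∨ u.val % 2 = v.val % 2)
  symm := ⟨fun u v h => ⟨h.1.symm, h.2.imp Ne.symm Eq.symm⟩⟩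
  loopless := ⟨fun u h => h.1 rfl⟩

instance : DecidableRel G8.Adj := fun u v => by unfold G8; infer_instance

theorem G8_rect : IsRectangleIntersectionGraph G8 := by
  refine ⟨fun v => if v.val < 4 then ((v.val % 2 : ℕ) : ℝ) else 0,
    fun v => if v.val < 4 then ((v.val % 2 : ℕ) : ℝ) else 1,
    fun v => if v.val < 4 then 0 else ((v.val % 2 : ℕ) : ℝ),
    fun v => if v.val < 4 then 1 else ((v.val % 2 : ℕ) : ℝ), ?_, ?_, ?_⟩
  · intro v; dsimp only; split_ifs <;> simp
  · intro v; dsimp only; split_ifs <;> simp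
  · intro u v huv
    rw [Set.prod_inter_prod, Set.prod_nonempty_iff, Set.Icc_inter_Icc, Set.Icc_inter_Icc,
      Set.nonempty_Icc, Set.nonempty_Icc]
    fin_cases u <;> fin_cases v <;> first | exact absurd rfl huv | (simp [G8])

/-- A set of four vertices inducing `2K₂` has a pair at large distance. -/
theorem exists_long {D : Fin 8 → Fin 8 → ℝ} {m M : ℝ}
    (hs : ∀ u v, D u v = D v u)
    (h4 : ∀ x y z t, D x y + D z t ≤ D x z + D y t ∨ D x y + D z t ≤ D x t + D y z)
    (hadj : ∀ u v, u ≠ v → (G8.Adj u v ↔ m ≤ D u v ∧ D u v ≤ M))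
    (a b c d : Fin 8) (hab : ¬ G8.Adj a b) (hbc : ¬ G8.Adj b c) (hcd : ¬ G8.Adj c d)
    (had : ¬ G8.Adj a d) (hac : G8.Adj a c) (hbd : G8.Adj b d)
    (nab : a ≠ b) (nbc : b ≠ c) (ncd : c ≠ d) (nad : a ≠ d) :
    M < D a b ∨ M < D b c ∨ M < D c d ∨ M < D a d := by
  by_contra! hcon
  obtain ⟨h1, h2, h3, h5⟩ := hcon
  rw [hadj _ _ nab] at hab
  rw [hadj _ _ nbc] at hbc
  rw [hadj _ _ ncd] at hcd
  rw [hadj _ _ nad] at had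
  have hac' := (hadj _ _ hac.ne).1 hac
  have hbd' := (hadj _ _ hbd.ne).1 hbd
  have k1 : D a b < m := not_le.1 fun h => hab ⟨h, h1⟩
  have k2 : D b c < m := not_le.1 fun h => hbc ⟨h, h2⟩
  have k3 : D c d < m := not_le.1 fun h => hcd ⟨h, h3⟩
  have k4 : D a d < m := not_le.1 fun h => had ⟨h, h5⟩
  have := hs b c
  rcases h4 a c b d with h | h <;> linarith

theorem G8_not_pcg : ¬ IsPCG G8 := by
  rintro ⟨n, T, w, f, m, M, hc, ha, hw, -, -, -, -, h⟩
  obtain ⟨D, hD, hs, h4⟩ := four_point hc ha w hw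
  obtain ⟨E, hE⟩ : ∃ E : Fin 8 → Fin 8 → ℝ, ∀ u v, E u v = D (f u) (f v) := ⟨_, fun _ _ => rfl⟩
  have hsE : ∀ u v, E u v = E v u := fun u v => by rw [hE, hE, hs]
  have h4E : ∀ x y z t, E x y + E z t ≤ E x z + E y t ∨ E x y + E z t ≤ E x t + E y z := by
    intro x y z t; simp only [hE]; exact h4 _ _ _ _
  have hadj : ∀ u v, u ≠ v → (G8.Adj u v ↔ m ≤ E u v ∧ E u v ≤ M) := by
    intro u v huv
    rw [h u v huv, hE]
    constructor
    · rintro ⟨p, hp, h1, h2⟩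
      rw [← hD _ _ p hp]
      exact ⟨h1, h2⟩
    · intro hh
      classical
      obtain ⟨p⟩ := hc.preconnected (f u) (f v)
      refine ⟨p.bypass, p.bypass_isPath, ?_⟩
      rw [← hD _ _ p.bypass p.bypass_isPath] at hh
      exact hh
  have hA : ∃ a b : Fin 8, a.val < 4 ∧ b.val < 4 ∧ M < E a b := by
    rcases exists_long hsE h4E hadj 0 1 2 3 (by decide) (by decide) (by decide) (by decide)
      (by decide) (by decide) (by decide) (by decide) (by decide) (by decide)
      with h | h | h | h
    all_goals exact ⟨_, _, by decide, by decide, h⟩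
  have hB : ∃ a b : Fin 8, 4 ≤ a.val ∧ 4 ≤ b.val ∧ M < E a b := by
    rcases exists_long hsE h4E hadj 4 5 6 7 (by decide) (by decide) (by decide) (by decide)
      (by decide) (by decide) (by decide) (by decide) (by decide) (by decide)
      with h | h | h | h
    all_goals exact ⟨_, _, by decide, by decide, h⟩
  obtain ⟨a, b, ha4, hb4, hab⟩ := hA
  obtain ⟨c, d, hc4, hd4, hcd⟩ := hB
  have hcross : ∀ u v : Fin 8, u.val < 4 → 4 ≤ v.val → E u v ≤ M := by
    intro u v hu hv
    have hne : u ≠ v := by rintro rfl; omega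
    exact ((hadj u v hne).1 ⟨hne, Or.inl (by omega)⟩).2
  have := hcross a c ha4 hc4
  have := hcross a d ha4 hd4
  have := hcross b c hb4 hc4
  have := hcross b d hb4 hd4
  rcases h4E a b c d with h | h <;> linarith

end PCGAux

/-- There exists a finite simple graph that is a rectangle intersection graph but is not a
pairwise compatibility graph. -/
theorem exists_RectangleIntersectionGraph_not_PCG :
    ∃ (n : ℕ) (G : SimpleGraph (Fin n)), IsRectangleIntersectionGraph G ∧ ¬ IsPCG G := by
  exact ⟨8, PCGAux.G8, PCGAux.G8_rect, PCGAux.G8_not_pcg⟩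
end

section
/- There exists a finite simple graph that is a tolerance graph but is not a pairwise compatibility graph (PCG). (Theorem 2.) -/
/-- `G` is a tolerance graph: each vertex gets a closed interval `[a, b]` and a
tolerance `t > 0`, and two distinct vertices are adjacent iff the length of the
intersection of their intervals is at least the minimum of their tolerances. -/
def IsToleranceGraph {V : Type} [Fintype V] (G : SimpleGraph V) : Prop :=
  ∃ a b t : V → ℝ,
    (∀ v, a v ≤ b v) ∧ (∀ v, 0 < t v) ∧
    ∀ u v : V, u ≠ v →
      (G.Adj u v ↔
        min (t u) (t v) ≤
          (MeasureTheory.volume (Set.Icc (a u) (b u) ∩ Set.Icc (a v) (b v))).toReal)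

/-- The weight of a walk. -/
noncomputable def walkWeight {n : ℕ} {T : SimpleGraph (Fin n)} (w : Sym2 (Fin n) → ℝ)
    {u v : Fin n} (p : T.Walk u v) : ℝ := (p.edges.map w).sum

theorem walkWeight_append {n : ℕ} {T : SimpleGraph (Fin n)} (w : Sym2 (Fin n) → ℝ)
    {u v x : Fin n} (p : T.Walk u v) (q : T.Walk v x) :
    walkWeight w (p.append q) = walkWeight w p + walkWeight w q := by
  simp [walkWeight, SimpleGraph.Walk.edges_append]

theorem walkWeight_reverse {n : ℕ} {T : SimpleGraph (Fin n)} (w : Sym2 (Fin n) → ℝ)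
    {u v : Fin n} (p : T.Walk u v) :
    walkWeight w p.reverse = walkWeight w p := by
  simp [walkWeight, SimpleGraph.Walk.edges_reverse, List.sum_reverse]

theorem walkWeight_bypass_le {n : ℕ} {T : SimpleGraph (Fin n)} (w : Sym2 (Fin n) → ℝ)
    (hw : ∀ e ∈ T.edgeSet, 0 ≤ w e) {u v : Fin n} (p : T.Walk u v) :
    walkWeight w p.bypass ≤ walkWeight w p := by
  unfold walkWeight
  apply List.Sublist.sum_le_sum
  · exact p.edges_bypass_sublist_edges.map w
  · intro a ha
    obtain ⟨e, he, rfl⟩ := List.mem_map.1 ha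
    exact hw e (p.edges_subset_edgeSet he)

/-- First hitting of a set by a walk. -/
theorem exists_first_hit {n : ℕ} {T : SimpleGraph (Fin n)} (S : Set (Fin n))
    {z x : Fin n} (q : T.Walk z x) (hx : x ∈ S) :
    ∃ m ∈ S, ∃ r : T.Walk z m, ∀ v ∈ r.support, v ∈ S → v = m := by
  induction q with
  | nil => exact ⟨_, hx, .nil, by simp⟩
  | @cons a b c h q ih =>
    by_cases ha : a ∈ S
    · exact ⟨a, ha, .nil, by simp⟩
    · obtain ⟨m, hm, r, hr⟩ := ih hx
      refine ⟨m, hm, .cons h r, ?_⟩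
      intro v hv hvS
      rw [SimpleGraph.Walk.support_cons, List.mem_cons] at hv
      rcases hv with rfl | hv
      · exact absurd hvS ha
      · exact hr v hv hvS

theorem isPath_append_of {n : ℕ} {T : SimpleGraph (Fin n)} {u v x : Fin n}
    {p : T.Walk u v} {q : T.Walk v x} (hp : p.IsPath) (hq : q.IsPath)
    (h : ∀ y ∈ p.support, y ∈ q.support → y = v) : (p.append q).IsPath := by
  apply SimpleGraph.Walk.IsPath.mk'
  rw [SimpleGraph.Walk.support_append, List.nodup_append']
  refine ⟨hp.support_nodup, hq.support_nodup.tail, ?_⟩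
  intro y hy hy'
  have h1 := h y hy (List.mem_of_mem_tail hy')
  subst h1
  have := hq.support_nodup
  rw [← SimpleGraph.Walk.cons_tail_support] at this
  exact (List.nodup_cons.1 this).1 hy'

theorem exists_tree_metric {n : ℕ} (T : SimpleGraph (Fin n)) (w : Sym2 (Fin n) → ℝ)
    (hc : T.Connected) (ha : T.IsAcyclic) (hw : ∀ e ∈ T.edgeSet, 0 ≤ w e) :
    ∃ D : Fin n → Fin n → ℝ,
      (∀ u v, ∃ p : T.Walk u v, p.IsPath) ∧
      (∀ u v (p : T.Walk u v), p.IsPath → walkWeight w p = D u v) ∧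
      (∀ u v, D u v = D v u) ∧
      (∀ x y z u, D x y + D z u ≤ max (D x z + D y u) (D x u + D y z)) := by
  have hex : ∀ u v, ∃ p : T.Walk u v, p.IsPath := fun u v => by
    obtain ⟨p⟩ := hc.preconnected u v
    exact ⟨p.bypass, p.bypass_isPath⟩
  choose P hP using hex
  let D : Fin n → Fin n → ℝ := fun u v => walkWeight w (P u v)
  have hD : ∀ u v (p : T.Walk u v), p.IsPath → walkWeight w p = D u v := by
    intro u v p hp
    have : (⟨p, hp⟩ : T.Path u v) = ⟨P u v, hP u v⟩ := (ha.subsingleton_path u v).elim _ _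
    have h2 : p = P u v := congrArg Subtype.val this
    rw [h2]
  have hsymm : ∀ u v, D u v = D v u := by
    intro u v
    rw [← hD v u _ (hP u v).reverse, walkWeight_reverse]
  have htri : ∀ u v x, D u x ≤ D u v + D v x := by
    intro u v x
    rw [← hD u x _ ((P u v).append (P v x)).bypass_isPath]
    refine (walkWeight_bypass_le w hw _).trans ?_
    rw [walkWeight_append]
  have hadd : ∀ u v m (p : T.Walk u v), p.IsPath → m ∈ p.support →
      D u v = D u m + D m v := by
    intro u v m p hp hm
    rw [← hD u v p hp, ← hD u m _ (hp.takeUntil hm), ← hD m v _ (hp.dropUntil hm),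
      ← walkWeight_append, SimpleGraph.Walk.take_spec]
  have hmed : ∀ x y z, ∃ m ∈ (P x y).support, D x z = D x m + D m z ∧
      D y z = D y m + D m z := by
    intro x y z
    obtain ⟨m, hm, r, hr⟩ := exists_first_hit {v | v ∈ (P x y).support} (P z x)
      (by simp)
    have hr' : ∀ v ∈ r.bypass.support, v ∈ (P x y).support → v = m :=
      fun v hv hv' => hr v (r.support_bypass_subset_support hv) hv'
    have h1 : (r.bypass.append ((P x y).takeUntil m hm).reverse).IsPath := by
      apply isPath_append_of r.bypass_isPath ((hP x y).takeUntil hm).reverse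
      intro v hv hv'
      apply hr' v hv
      rw [SimpleGraph.Walk.support_reverse, List.mem_reverse] at hv'
      exact SimpleGraph.Walk.support_takeUntil_subset_support _ hm hv'
    have h2 : (r.bypass.append ((P x y).dropUntil m hm)).IsPath := by
      apply isPath_append_of r.bypass_isPath ((hP x y).dropUntil hm)
      intro v hv hv'
      apply hr' v hv
      exact SimpleGraph.Walk.support_dropUntil_subset_support _ hm hv'
    refine ⟨m, hm, ?_, ?_⟩
    · have := hadd z x m _ h1 (by simp [SimpleGraph.Walk.mem_support_append_iff])
      rw [hsymm x z, this, hsymm z m, hsymm m x]; ring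
    · have := hadd z y m _ h2 (by simp [SimpleGraph.Walk.mem_support_append_iff])
      rw [hsymm y z, this, hsymm z m, hsymm m y]; ring
  refine ⟨D, fun u v => ⟨P u v, hP u v⟩, hD, hsymm, ?_⟩
  intro x y z u
  obtain ⟨m, hm, h1, h2⟩ := hmed x y z
  obtain ⟨k, hk, h3, h4⟩ := hmed x y u
  have hxm := hadd x y m _ (hP x y) hm
  have hxk := hadd x y k _ (hP x y) hk
  have t1 := htri z m u
  have t2 := htri m k u
  have s1 := hsymm z m
  have s2 := hsymm m k
  have s3 := hsymm y m
  have s4 := hsymm y k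
  have hm' := hm
  rw [← (P x y).take_spec hk, SimpleGraph.Walk.mem_support_append_iff] at hm'
  rcases hm' with hm' | hm'
  · have := hadd x k m _ ((hP x y).takeUntil hk) hm'
    apply le_max_of_le_right
    linarith
  · have := hadd k y m _ ((hP x y).dropUntil hk) hm'
    apply le_max_of_le_left
    linarith

/-- The join of two copies of `2K₂`. -/
def joinGraph : SimpleGraph (Fin 8) where
  Adj u v := u ≠ v ∧ (u.val / 2 = v.val / 2 ∨ u.val / 4 ≠ v.val / 4)
  symm := ⟨fun u v h => ⟨h.1.symm, h.2.imp Eq.symm Ne.symm⟩⟩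
  loopless := ⟨fun u h => h.1 rfl⟩

set_option maxHeartbeats 4000000 in
theorem joinGraph_tolerance : IsToleranceGraph joinGraph := by
  refine ⟨![0, 0, 2, 2, -10, -10, 0, 0], ![1, 1, 3, 3, 3, 3, 13, 13],
    ![1/2, 1/2, 1/2, 1/2, 5, 5, 5, 5], ?_, ?_, ?_⟩
  · intro v; fin_cases v <;> norm_num
  · intro v; fin_cases v <;> norm_num
  · intro u v huv
    rw [Set.Icc_inter_Icc, Real.volume_Icc, ENNReal.toReal_ofReal']
    fin_cases u <;> fin_cases v <;> first
      | exact absurd rfl huv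
      | (simp [joinGraph]; done)
      | (simp [joinGraph]; norm_num; done)
      | (norm_num [joinGraph, max_def, min_def])

theorem joinGraph_not_PCG : ¬ IsPCG joinGraph := by
  rintro ⟨n, T, w, f, dmin, dmax, hc, ha, hw, -, -, -, -, hadj⟩
  obtain ⟨D, hex, hD, hsymm, h4⟩ := exists_tree_metric T w hc ha hw
  have key : ∀ u v : Fin 8, u ≠ v →
      (joinGraph.Adj u v ↔ dmin ≤ D (f u) (f v) ∧ D (f u) (f v) ≤ dmax) := by
    intro u v huv
    rw [hadj u v huv]
    constructor
    · rintro ⟨p, hp, h⟩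
      have := hD _ _ p hp
      unfold walkWeight at this
      rwa [this] at h
    · intro h
      obtain ⟨p, hp⟩ := hex (f u) (f v)
      refine ⟨p, hp, ?_⟩
      have := hD _ _ p hp
      unfold walkWeight at this
      rwa [this]
  have adj : ∀ u v : Fin 8, u ≠ v → (u.val / 2 = v.val / 2 ∨ u.val / 4 ≠ v.val / 4) →
      dmin ≤ D (f u) (f v) ∧ D (f u) (f v) ≤ dmax :=
    fun u v huv h => (key u v huv).1 ⟨huv, h⟩
  have nadj : ∀ u v : Fin 8, u ≠ v → ¬ (u.val / 2 = v.val / 2 ∨ u.val / 4 ≠ v.val / 4) →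
      dmin ≤ D (f u) (f v) → dmax < D (f u) (f v) := by
    intro u v huv h h1
    by_contra h2
    exact h ((key u v huv).2 ⟨h1, not_lt.1 h2⟩).2
  -- each of the two four-cycles of the complement has a long pair
  have long : ∀ a b c d : Fin 8, a ≠ b → c ≠ d → a.val / 2 = b.val / 2 →
      c.val / 2 = d.val / 2 → a.val / 2 ≠ c.val / 2 → a.val / 4 = c.val / 4 →
      ∃ s t : Fin 8, s.val / 4 = a.val / 4 ∧ t.val / 4 = a.val / 4 ∧
        dmax < D (f s) (f t) := by
    intro a b c d hab hcd h1 h2 h3 h5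
    by_contra hcon
    push Not at hcon
    have short : ∀ s t : Fin 8, s.val / 4 = a.val / 4 → t.val / 4 = a.val / 4 →
        s.val / 2 ≠ t.val / 2 → D (f s) (f t) < dmin := by
      intro s t hs ht hst
      by_contra hlt
      have hne : s ≠ t := fun h => hst (by rw [h])
      have := nadj s t hne (by omega) (not_lt.1 hlt)
      exact absurd this (not_lt.2 (hcon s t hs ht))
    have e1 := (adj a b hab (Or.inl h1)).1
    have e2 := (adj c d hcd (Or.inl h2)).1
    have e3 := short a c (by omega) (by omega) (by omega)
    have e4 := short b d (by omega) (by omega) (by omega)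
    have e5 := short a d (by omega) (by omega) (by omega)
    have e6 := short b c (by omega) (by omega) (by omega)
    rcases le_max_iff.1 (h4 (f a) (f b) (f c) (f d)) with h | h <;> linarith
  obtain ⟨a, c, ha', hc', hac⟩ := long 0 1 2 3 (by decide) (by decide) (by decide)
    (by decide) (by decide) (by decide)
  obtain ⟨e, g, he', hg', heg⟩ := long 4 5 6 7 (by decide) (by decide) (by decide)
    (by decide) (by decide) (by decide)
  have ha2 : a.val / 4 = 0 := ha'
  have hc2 : c.val / 4 = 0 := hc'
  have he2 : e.val / 4 = 1 := he'
  have hg2 : g.val / 4 = 1 := hg'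
  have cross : ∀ s t : Fin 8, s.val / 4 = 0 → t.val / 4 = 1 → D (f s) (f t) ≤ dmax := by
    intro s t hs ht
    refine (adj s t ?_ (Or.inr (by omega))).2
    rintro rfl
    omega
  have c1 := cross a e ha2 he2
  have c2 := cross a g ha2 hg2
  have c3 := cross c e hc2 he2
  have c4 := cross c g hc2 hg2
  rcases le_max_iff.1 (h4 (f a) (f c) (f e) (f g)) with h | h <;> linarith

/-- There exists a finite simple graph that is a tolerance graph but is not a
pairwise compatibility graph. -/
theorem exists_ToleranceGraph_not_PCG :
    ∃ (n : ℕ) (G : SimpleGraph (Fin n)), IsToleranceGraph G ∧ ¬ IsPCG G :=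
  ⟨8, joinGraph, joinGraph_tolerance, joinGraph_not_PCG⟩
end
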